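/- Let Σ and Σⱼ be positive definite D×D real matrices and μ, μⱼ ∈ ℝ^D, and let p(t) = N_D(t; μ, Σ) and ψ(t) = N_D(t; μⱼ, Σⱼ). Set s̃ = N_D(μ; μⱼ, Σ + Σⱼ), Σ̃ = (Σ⁻¹ + Σⱼ⁻¹)⁻¹, and μ̃ = Σ̃(Σ⁻¹μ + Σⱼ⁻¹μⱼ). Then ∫_{ℝ^D} ttᵀ p(t)ψ(t) dt − (Σ + μμᵀ)(∫_{ℝ^D} p(t)ψ(t) dt) = s̃ (Σ̃ + μ̃μ̃ᵀ − Σ − μμᵀ); i.e. the covariance cov_p(ttᵀ, ψ(t)) under p equals s̃(Σ̃ + μ̃μ̃ᵀ − Σ − μμᵀ). -/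

import Mathlib

open Real Matrix

/-- The `D`-dimensional Gaussian density
`N_D(x; μ, Σ) = (2π)^(−D/2) (det Σ)^(−1/2) exp(−(1/2)(x−μ)ᵀΣ⁻¹(x−μ))`. -/
noncomputable def gaussDensity {D : ℕ} (μ : Fin D → ℝ) (C : Matrix (Fin D) (Fin D) ℝ)
    (x : Fin D → ℝ) : ℝ :=
  (2 * Real.pi) ^ (-(D : ℝ) / 2) * C.det ^ (-(1 : ℝ) / 2) *
    Real.exp (-(1 / 2) * ((x - μ) ⬝ᵥ C⁻¹.mulVec (x - μ)))

open MeasureTheory ProbabilityTheory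
open scoped MatrixOrder

lemma integrable_gaussianPDFReal_mul_pow (n : ℕ) :
    Integrable (fun x : ℝ => gaussianPDFReal 0 1 x * x ^ n) := by
  have h := (memLp_id_gaussianReal (μ := 0) (v := 1) n).integrable_norm_pow'
  have h' : Integrable (fun x : ℝ => x ^ n) (gaussianReal 0 1) := by
    refine h.mono (by fun_prop) (ae_of_all _ fun x => ?_)
    simp
  rw [gaussianReal_of_var_ne_zero 0 one_ne_zero,
    integrable_withDensity_iff_integrable_smul' (measurable_gaussianPDF _ _)
      (ae_of_all _ fun _ => gaussianPDF_lt_top)] at h'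
  simpa using h'

lemma integral_gaussianPDFReal_mul_id : ∫ x : ℝ, gaussianPDFReal 0 1 x * x = 0 := by
  have h := integral_gaussianReal_eq_integral_smul (μ := 0) (f := fun x : ℝ => x) one_ne_zero
  rw [integral_id_gaussianReal] at h
  simpa using h.symm

lemma integral_gaussianPDFReal_mul_sq : ∫ x : ℝ, gaussianPDFReal 0 1 x * x ^ 2 = 1 := by
  have h := integral_gaussianReal_eq_integral_smul (μ := 0) (f := fun x : ℝ => x ^ 2) one_ne_zero
  have hv := variance_id_gaussianReal (μ := 0) (v := 1)
  rw [variance_of_integral_eq_zero (by fun_prop) (by simp)] at hv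
  simp only [smul_eq_mul] at h
  rw [← h]
  simpa using hv

section StandardGaussian

variable {ι : Type*} [Fintype ι]

lemma integrable_prod_gaussianPDFReal_mul_pow (n : ι → ℕ) :
    Integrable (fun x : ι → ℝ => (∏ k, gaussianPDFReal 0 1 (x k)) * ∏ k, x k ^ n k) := by
  simp_rw [← Finset.prod_mul_distrib]
  exact Integrable.fintype_prod fun k => integrable_gaussianPDFReal_mul_pow (n k)

lemma integral_prod_gaussianPDFReal_mul_pow (n : ι → ℕ) :
    ∫ x : ι → ℝ, (∏ k, gaussianPDFReal 0 1 (x k)) * ∏ k, x k ^ n k =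
      ∏ k, ∫ x : ℝ, gaussianPDFReal 0 1 x * x ^ n k := by
  simp_rw [← Finset.prod_mul_distrib]
  exact integral_fintype_prod_volume_eq_prod
    (fun k (x : ℝ) => gaussianPDFReal 0 1 x * x ^ n k)

lemma integrable_prod_gaussianPDFReal :
    Integrable (fun x : ι → ℝ => ∏ k, gaussianPDFReal 0 1 (x k)) := by
  simpa using integrable_prod_gaussianPDFReal_mul_pow (0 : ι → ℕ)

lemma integral_prod_gaussianPDFReal :
    ∫ x : ι → ℝ, ∏ k, gaussianPDFReal 0 1 (x k) = 1 := by
  simpa [integral_gaussianPDFReal_eq_one] using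
    integral_prod_gaussianPDFReal_mul_pow (0 : ι → ℕ)

variable [DecidableEq ι]

lemma prod_pow_single (x : ι → ℝ) (i : ι) :
    ∏ k, x k ^ (Pi.single i 1 : ι → ℕ) k = x i := by
  rw [Finset.prod_eq_single i (fun k _ hk => by simp [hk]) (by simp)]
  simp

lemma prod_pow_single_add_single (x : ι → ℝ) (i j : ι) :
    ∏ k, x k ^ (Pi.single i 1 + Pi.single j 1 : ι → ℕ) k = x i * x j := by
  simp only [Pi.add_apply, pow_add, Finset.prod_mul_distrib, prod_pow_single]

lemma integrable_prod_gaussianPDFReal_mul_apply (i : ι) :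
    Integrable (fun x : ι → ℝ => (∏ k, gaussianPDFReal 0 1 (x k)) * x i) := by
  simpa only [prod_pow_single] using
    integrable_prod_gaussianPDFReal_mul_pow (Pi.single i 1 : ι → ℕ)

lemma integral_prod_gaussianPDFReal_mul_apply (i : ι) :
    ∫ x : ι → ℝ, (∏ k, gaussianPDFReal 0 1 (x k)) * x i = 0 := by
  have h := integral_prod_gaussianPDFReal_mul_pow (Pi.single i 1 : ι → ℕ)
  simp only [prod_pow_single] at h
  rw [h]
  exact Finset.prod_eq_zero (Finset.mem_univ i) (by simpa using integral_gaussianPDFReal_mul_id)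

lemma integrable_prod_gaussianPDFReal_mul_apply_mul_apply (i j : ι) :
    Integrable (fun x : ι → ℝ => (∏ k, gaussianPDFReal 0 1 (x k)) * (x i * x j)) := by
  have h := integrable_prod_gaussianPDFReal_mul_pow (Pi.single i 1 + Pi.single j 1 : ι → ℕ)
  simp only [prod_pow_single_add_single] at h
  exact h

lemma integral_prod_gaussianPDFReal_mul_apply_mul_apply (i j : ι) :
    ∫ x : ι → ℝ, (∏ k, gaussianPDFReal 0 1 (x k)) * (x i * x j) =
      (1 : Matrix ι ι ℝ) i j := by
  have h := integral_prod_gaussianPDFReal_mul_pow (Pi.single i 1 + Pi.single j 1 : ι → ℕ)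
  simp only [prod_pow_single_add_single] at h
  rw [h]
  rcases eq_or_ne i j with rfl | hij
  · rw [Matrix.one_apply_eq]
    refine Finset.prod_eq_one fun k _ => ?_
    rcases eq_or_ne k i with rfl | hk
    · simpa using integral_gaussianPDFReal_mul_sq
    · simp [hk, integral_gaussianPDFReal_eq_one]
  · rw [Matrix.one_apply_ne hij]
    refine Finset.prod_eq_zero (Finset.mem_univ i) ?_
    simpa [hij] using integral_gaussianPDFReal_mul_id

lemma integral_prod_gaussianPDFReal_mul_affine_mul_affine (A : Matrix ι ι ℝ) (m : ι → ℝ)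
    (i j : ι) :
    ∫ x : ι → ℝ, (∏ k, gaussianPDFReal 0 1 (x k)) * ((m + A *ᵥ x) i * (m + A *ᵥ x) j) =
      (A * Aᵀ) i j + m i * m j := by
  have expand : ∀ x : ι → ℝ,
      (∏ k, gaussianPDFReal 0 1 (x k)) * ((m + A *ᵥ x) i * (m + A *ᵥ x) j) =
        m i * m j * (∏ k, gaussianPDFReal 0 1 (x k)) +
        ∑ l, (m i * A j l + m j * A i l) * ((∏ k, gaussianPDFReal 0 1 (x k)) * x l) +
        ∑ l, ∑ r, A i l * A j r * ((∏ k, gaussianPDFReal 0 1 (x k)) * (x l * x r)) := by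
    intro x
    have h₁ : ∑ l, (m i * A j l + m j * A i l) * ((∏ k, gaussianPDFReal 0 1 (x k)) * x l) =
        (∏ k, gaussianPDFReal 0 1 (x k)) * (m i * ∑ l, A j l * x l + m j * ∑ l, A i l * x l) := by
      simp only [Finset.mul_sum, ← Finset.sum_add_distrib]
      exact Finset.sum_congr rfl fun l _ => by ring
    have h₂ : ∑ l, ∑ r, A i l * A j r * ((∏ k, gaussianPDFReal 0 1 (x k)) * (x l * x r)) =
        (∏ k, gaussianPDFReal 0 1 (x k)) * ((∑ l, A i l * x l) * ∑ r, A j r * x r) := by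
      rw [Finset.sum_mul_sum]
      simp only [Finset.mul_sum]
      exact Finset.sum_congr rfl fun l _ => Finset.sum_congr rfl fun r _ => by ring
    rw [h₁, h₂]
    simp only [Pi.add_apply, mulVec, dotProduct]
    ring
  have int₀ := (integrable_prod_gaussianPDFReal (ι := ι)).const_mul (m i * m j)
  have int₁ := fun l => (integrable_prod_gaussianPDFReal_mul_apply l).const_mul
    (m i * A j l + m j * A i l)
  have int₂ := fun l r => (integrable_prod_gaussianPDFReal_mul_apply_mul_apply l r).const_mul
    (A i l * A j r)
  simp_rw [expand]
  rw [integral_add (f := fun x => _ + _) (int₀.add (integrable_finsetSum _ fun l _ => int₁ l))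
      (integrable_finsetSum _ fun l _ => integrable_finsetSum _ fun r _ => int₂ l r),
    integral_add int₀ (integrable_finsetSum _ fun l _ => int₁ l),
    integral_finsetSum _ fun l _ => int₁ l,
    integral_finsetSum _ fun l _ => integrable_finsetSum _ fun r _ => int₂ l r]
  simp_rw [fun l => integral_finsetSum (μ := volume) Finset.univ fun r _ => int₂ l r,
    integral_const_mul, integral_prod_gaussianPDFReal, integral_prod_gaussianPDFReal_mul_apply,
    integral_prod_gaussianPDFReal_mul_apply_mul_apply]
  simp [Matrix.mul_apply, Matrix.one_apply]
  ring

lemma integral_eq_abs_det_mul_integral_affine {A : Matrix ι ι ℝ} (hA : A.det ≠ 0) (m : ι → ℝ)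
    (f : (ι → ℝ) → ℝ) :
    ∫ t, f t = |A.det| * ∫ x, f (m + A *ᵥ x) := by
  have hmap := Real.map_matrix_volume_pi_eq_smul_volume_pi hA
  have hu : IsUnit A.det := isUnit_iff_ne_zero.2 hA
  have hemb : MeasurableEmbedding (toLin' A) := by
    have h : Topology.IsClosedEmbedding (toLin' A) := by
      refine LinearMap.isClosedEmbedding_of_injective (LinearMap.ker_eq_bot.2 ?_)
      exact Matrix.mulVec_injective_iff_isUnit.2 ((Matrix.isUnit_iff_isUnit_det A).2 hu)
    exact h.measurableEmbedding
  have h := hemb.integral_map (μ := volume) (fun y => f (m + y))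
  rw [hmap, integral_smul_measure, integral_add_left_eq_self f m,
    ENNReal.toReal_ofReal (abs_nonneg _), smul_eq_mul] at h
  simp only [toLin'_apply] at h
  rw [← h, ← mul_assoc, ← abs_mul, mul_inv_cancel₀ hA, abs_one, one_mul]

end StandardGaussian

lemma abs_det_mul_gaussDensity_affine {D : ℕ} {A : Matrix (Fin D) (Fin D) ℝ} (hA : A.det ≠ 0)
    (m x : Fin D → ℝ) :
    |A.det| * gaussDensity m (A * Aᵀ) (m + A *ᵥ x) = ∏ k, gaussianPDFReal 0 1 (x k) := by
  have hu : IsUnit A.det := isUnit_iff_ne_zero.2 hA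
  have hquad : (A *ᵥ x) ⬝ᵥ ((A * Aᵀ)⁻¹ *ᵥ (A *ᵥ x)) = ∑ k, x k ^ 2 := by
    have h : Aᵀ * ((A * Aᵀ)⁻¹ * A) = 1 := by
      rw [Matrix.mul_inv_rev, Matrix.mul_assoc, Matrix.nonsing_inv_mul _ hu, Matrix.mul_one,
        Matrix.mul_nonsing_inv _ (by rwa [Matrix.det_transpose])]
    rw [dotProduct_comm, Matrix.dotProduct_mulVec, ← Matrix.mulVec_transpose, Matrix.mulVec_mulVec,
      Matrix.mulVec_mulVec, Matrix.mul_assoc, h, Matrix.one_mulVec]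
    simp [dotProduct, sq]
  have hdet : (A * Aᵀ).det ^ (-(1 : ℝ) / 2) = |A.det|⁻¹ := by
    rw [Matrix.det_mul, Matrix.det_transpose, ← abs_mul_abs_self, ← sq, ← Real.rpow_natCast,
      ← Real.rpow_mul (abs_nonneg _), ← Real.rpow_neg_one]
    norm_num
  have hpi : (2 * π) ^ (-(D : ℝ) / 2) = ∏ _k : Fin D, (√(2 * π))⁻¹ := by
    rw [Finset.prod_const, Finset.card_univ, Fintype.card_fin, Real.sqrt_eq_rpow,
      ← Real.rpow_neg (by positivity), ← Real.rpow_natCast, ← Real.rpow_mul (by positivity)]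
    congr 1
    ring
  simp only [gaussDensity, gaussianPDFReal, add_sub_cancel_left, hquad, hdet, hpi,
    Finset.prod_mul_distrib, ← Real.exp_sum, NNReal.coe_one, mul_one, sub_zero,
    ← Finset.sum_div, Finset.sum_neg_distrib]
  have : |A.det| ≠ 0 := abs_ne_zero.2 hA
  rw [show -(1 / 2) * ∑ k, x k ^ 2 = (-∑ k, x k ^ 2) / 2 by ring]
  field_simp

lemma Matrix.PosDef.exists_eq_mul_transpose {D : ℕ} {C : Matrix (Fin D) (Fin D) ℝ}
    (hC : C.PosDef) : ∃ A : Matrix (Fin D) (Fin D) ℝ, A.det ≠ 0 ∧ C = A * Aᵀ := by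
  obtain ⟨B, hB⟩ :=
    CStarAlgebra.nonneg_iff_eq_star_mul_self.1 hC.posSemidef.nonneg
  rw [Matrix.star_eq_conjTranspose, Matrix.conjTranspose_eq_transpose_of_trivial] at hB
  refine ⟨Bᵀ, fun h => hC.det_pos.ne' ?_, by rw [Matrix.transpose_transpose, hB]⟩
  rw [hB, Matrix.det_mul, h, zero_mul]

lemma integral_gaussDensity {D : ℕ} {C : Matrix (Fin D) (Fin D) ℝ} (hC : C.PosDef)
    (m : Fin D → ℝ) : ∫ t, gaussDensity m C t = 1 := by
  obtain ⟨A, hA, rfl⟩ := hC.exists_eq_mul_transpose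
  rw [integral_eq_abs_det_mul_integral_affine hA m, ← integral_const_mul]
  simp_rw [abs_det_mul_gaussDensity_affine hA]
  exact integral_prod_gaussianPDFReal

lemma integral_gaussDensity_mul_apply_mul_apply {D : ℕ} {C : Matrix (Fin D) (Fin D) ℝ}
    (hC : C.PosDef) (m : Fin D → ℝ) (i j : Fin D) :
    ∫ t, gaussDensity m C t * (t i * t j) = C i j + m i * m j := by
  obtain ⟨A, hA, rfl⟩ := hC.exists_eq_mul_transpose
  rw [integral_eq_abs_det_mul_integral_affine hA m, ← integral_const_mul]
  simp_rw [← mul_assoc |A.det|, abs_det_mul_gaussDensity_affine hA]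
  exact integral_prod_gaussianPDFReal_mul_affine_mul_affine A m i j

section Product

variable {ι : Type*} [Fintype ι] [DecidableEq ι] {C K : Matrix ι ι ℝ}

lemma Matrix.PosDef.inv_add_inv_eq (hC : C.PosDef) (hK : K.PosDef) :
    C⁻¹ + K⁻¹ = C⁻¹ * (C + K) * K⁻¹ := by
  rw [Matrix.mul_add, Matrix.nonsing_inv_mul _ hC.det_pos.ne'.isUnit, Matrix.add_mul,
    Matrix.one_mul, Matrix.mul_assoc, Matrix.mul_nonsing_inv _ hK.det_pos.ne'.isUnit,
    Matrix.mul_one, add_comm]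

lemma Matrix.PosDef.det_mul_det_eq (hC : C.PosDef) (hK : K.PosDef) :
    C.det * K.det = (C + K).det * (C⁻¹ + K⁻¹)⁻¹.det := by
  have h₁ := hC.det_pos.ne'
  have h₂ := hK.det_pos.ne'
  have h₃ := (hC.add hK).det_pos.ne'
  rw [hC.inv_add_inv_eq hK]
  simp only [Matrix.det_nonsing_inv, Matrix.det_mul, Ring.inverse_eq_inv']
  field_simp

lemma Matrix.PosDef.quadratic_add_quadratic_eq (hC : C.PosDef) (hK : K.PosDef)
    (μ ν t m : ι → ℝ) (hm : m = (C⁻¹ + K⁻¹)⁻¹ *ᵥ (C⁻¹ *ᵥ μ + K⁻¹ *ᵥ ν)) :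
    (t - μ) ⬝ᵥ C⁻¹ *ᵥ (t - μ) + (t - ν) ⬝ᵥ K⁻¹ *ᵥ (t - ν) =
      (μ - ν) ⬝ᵥ (C + K)⁻¹ *ᵥ (μ - ν) +
        (t - m) ⬝ᵥ (C⁻¹ + K⁻¹) *ᵥ (t - m) := by
  have hCu := hC.det_pos.ne'.isUnit
  have hKu := hK.det_pos.ne'.isUnit
  have hSu := (hC.inv.add hK.inv).det_pos.ne'.isUnit
  have hCKu := (hC.add hK).det_pos.ne'.isUnit
  have symm_form : ∀ {M : Matrix ι ι ℝ}, M.PosDef → ∀ x y : ι → ℝ,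
      x ⬝ᵥ M *ᵥ y = y ⬝ᵥ M *ᵥ x := by
    intro M hM x y
    have hMT : Mᵀ = M := by
      rw [← Matrix.conjTranspose_eq_transpose_of_trivial]; exact hM.isHermitian
    rw [Matrix.dotProduct_mulVec, ← Matrix.mulVec_transpose, hMT, dotProduct_comm]
  have hsum : C⁻¹ *ᵥ (m - μ) + K⁻¹ *ᵥ (m - ν) = 0 := by
    have h : (C⁻¹ + K⁻¹) *ᵥ m = C⁻¹ *ᵥ μ + K⁻¹ *ᵥ ν := by
      rw [hm, Matrix.mulVec_mulVec, Matrix.mul_nonsing_inv _ hSu, Matrix.one_mulVec]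
    rw [Matrix.add_mulVec] at h
    rw [Matrix.mulVec_sub, Matrix.mulVec_sub, sub_add_sub_comm, h, sub_self]
  have hK' : K⁻¹ *ᵥ (m - ν) = -(C⁻¹ *ᵥ (m - μ)) := (neg_eq_of_add_eq_zero_right hsum).symm
  have hC' : C⁻¹ *ᵥ (m - μ) = -((C + K)⁻¹ *ᵥ (μ - ν)) := by
    have h : (C + K) *ᵥ (C⁻¹ *ᵥ (m - μ)) = -(μ - ν) := by
      have hKm : K *ᵥ (C⁻¹ *ᵥ (m - μ)) = -(m - ν) := by
        rw [← neg_eq_iff_eq_neg.2 hK', Matrix.mulVec_neg, Matrix.mulVec_mulVec,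
          Matrix.mul_nonsing_inv _ hKu, Matrix.one_mulVec]
      rw [Matrix.add_mulVec, hKm, Matrix.mulVec_mulVec, Matrix.mul_nonsing_inv _ hCu,
        Matrix.one_mulVec]
      abel
    rw [← Matrix.mulVec_neg, ← h, Matrix.mulVec_mulVec, Matrix.nonsing_inv_mul _ hCKu,
      Matrix.one_mulVec]
  have ht₁ : t - μ = (t - m) + (m - μ) := by abel
  have ht₂ : t - ν = (t - m) + (m - ν) := by abel
  have hd : μ - ν = (m - ν) - (m - μ) := by abel
  have e₁ := symm_form hC.inv (m - μ) (t - m)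
  have e₂ := symm_form hK.inv (m - ν) (t - m)
  have e₃ : (μ - ν) ⬝ᵥ (C + K)⁻¹ *ᵥ (μ - ν) =
      (m - μ) ⬝ᵥ C⁻¹ *ᵥ (m - μ) - (m - ν) ⬝ᵥ C⁻¹ *ᵥ (m - μ) := by
    rw [← neg_eq_iff_eq_neg.2 hC', hd, sub_dotProduct, dotProduct_neg, dotProduct_neg]
    ring
  rw [e₃, ht₁, ht₂]
  simp only [Matrix.mulVec_add, Matrix.add_mulVec, add_dotProduct, dotProduct_add, e₁, e₂]
  rw [hK']
  simp only [dotProduct_neg]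
  ring

end Product

lemma gaussDensity_mul_gaussDensity {D : ℕ} {C K : Matrix (Fin D) (Fin D) ℝ} (hC : C.PosDef)
    (hK : K.PosDef) (μ ν t : Fin D → ℝ) :
    gaussDensity μ C t * gaussDensity ν K t =
      gaussDensity ν (C + K) μ *
        gaussDensity ((C⁻¹ + K⁻¹)⁻¹ *ᵥ (C⁻¹ *ᵥ μ + K⁻¹ *ᵥ ν)) (C⁻¹ + K⁻¹)⁻¹ t := by
  have hS := hC.inv.add hK.inv
  have hdet : C.det ^ (-(1 : ℝ) / 2) * K.det ^ (-(1 : ℝ) / 2) =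
      (C + K).det ^ (-(1 : ℝ) / 2) * (C⁻¹ + K⁻¹)⁻¹.det ^ (-(1 : ℝ) / 2) := by
    rw [← Real.mul_rpow hC.det_pos.le hK.det_pos.le, hC.det_mul_det_eq hK,
      Real.mul_rpow (hC.add hK).det_pos.le hS.inv.det_pos.le]
  have hq := hC.quadratic_add_quadratic_eq hK μ ν t _ rfl
  simp only [gaussDensity]
  rw [Matrix.nonsing_inv_nonsing_inv _ hS.det_pos.ne'.isUnit]
  have hexp : ∀ a b c d : ℝ, a + b = c + d →
      Real.exp (-(1 / 2) * a) * Real.exp (-(1 / 2) * b) =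
        Real.exp (-(1 / 2) * c) * Real.exp (-(1 / 2) * d) := by
    intro a b c d h
    rw [← Real.exp_add, ← Real.exp_add, ← mul_add, ← mul_add, h]
  rw [mul_mul_mul_comm, mul_mul_mul_comm (_ ^ _), hdet, hexp _ _ _ _ hq]
  ring

/-- Second-moment rows of the Jacobian of continuous softmax attention, entrywise:
for `p = N(·; μ, Σ)` and `ψ = N(·; μⱼ, Σⱼ)`,
`cov_p(ttᵀ, ψ(t)) = s̃ (Σ̃ + μ̃μ̃ᵀ − Σ − μμᵀ)`, using `E_p[ttᵀ] = Σ + μμᵀ`. -/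
theorem stmt_18 (D : ℕ)
    (C Cj : Matrix (Fin D) (Fin D) ℝ) (hC : C.PosDef) (hCj : Cj.PosDef)
    (μ μj : Fin D → ℝ)
    (st : ℝ) (hst : st = gaussDensity μj (C + Cj) μ)
    (Ct : Matrix (Fin D) (Fin D) ℝ) (hCt : Ct = (C⁻¹ + Cj⁻¹)⁻¹)
    (mt : Fin D → ℝ) (hmt : mt = Ct.mulVec (C⁻¹.mulVec μ + Cj⁻¹.mulVec μj)) :
    ∀ i j : Fin D,
      (∫ t : Fin D → ℝ, gaussDensity μ C t * gaussDensity μj Cj t * (t i * t j)) -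
          (C i j + μ i * μ j) *
            (∫ t : Fin D → ℝ, gaussDensity μ C t * gaussDensity μj Cj t) =
        st * (Ct i j + mt i * mt j - C i j - μ i * μ j) := by
  intro i j
  subst hst hCt hmt
  simp_rw [gaussDensity_mul_gaussDensity hC hCj μ μj, mul_assoc, integral_const_mul]
  have hCt := (hC.inv.add hCj.inv).inv
  rw [integral_gaussDensity hCt, integral_gaussDensity_mul_apply_mul_apply hCt]
  ring
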